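/- Let G = (X,E) be a finite connected graph without dead ends. Then the dimension of the (−1)-eigenspace of the edge Laplacian satisfies: dim_ℂ E_{−1}(Δᵉ; Maps(E,ℂ)) = 2 if G is 2-colorable and c(G) = 1; dim_ℂ E_{−1}(Δᵉ; Maps(E,ℂ)) = c(G) if G is 2-colorable and c(G) ≠ 1; and dim_ℂ E_{−1}(Δᵉ; Maps(E,ℂ)) = c(G) − 1 if G is not 2-colorable. -/

import Mathlib

open Function Set
open scoped Classical

namespace GraphQCC

variable {X : Type} (G : SimpleGraph X)

/-- The set of directed edges of a (symmetric, loopless) graph. -/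
abbrev DE := {p : X × X // G.Adj p.1 p.2}

variable {G}

/-- Initial vertex of a directed edge. -/
def ini (e : DE G) : X := e.1.1

/-- Terminal vertex of a directed edge. -/
def ter (e : DE G) : X := e.1.2

/-- Opposite edge. -/
def op (e : DE G) : DE G := ⟨(e.1.2, e.1.1), e.2.symm⟩

variable (G)

/-- Degree of a vertex: the number of directed edges starting at it. -/
noncomputable def deg (x : X) : ℕ := Set.ncard {e : DE G | ini e = x}

/-- The graph is locally finite: every vertex has finite degree. -/
def LocFin : Prop := ∀ x : X, {e : DE G | ini e = x}.Finite

/-- The edge Laplacian. -/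
noncomputable def edgeLap (f : DE G → ℂ) (e : DE G) : ℂ :=
  ∑ᶠ e' ∈ {e' : DE G | ini e' = ter e ∧ e' ≠ op e}, f e'

/-- The `z`-eigenspace of the edge Laplacian, as a set of functions on directed edges. -/
def edgeEig (z : ℂ) : Set (DE G → ℂ) := {f | ∀ e, edgeLap G f e = z * f e}

/-- The edge inversion operator Ξ. -/
def Xi (f : DE G → ℂ) (e : DE G) : ℂ := f (op e)

/-- The operator Σ (sum over edges with the same initial point). -/
noncomputable def Sig (f : DE G → ℂ) (e : DE G) : ℂ :=
  ∑ᶠ e' ∈ {e' : DE G | ini e' = ini e}, f e'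

/-- Edges pointing away from a vertex `o`. -/
def away (o : X) : Set (DE G) := {e | G.dist o (ter e) = G.dist o (ini e) + 1}

/-- The edge Laplacian on functions on the edges pointing away from `o`. -/
noncomputable def edgeLapAway (o : X) (f : ↥(away G o) → ℂ) (e : ↥(away G o)) : ℂ :=
  ∑ᶠ e' ∈ {e' : ↥(away G o) | ini e'.1 = ter e.1 ∧ e'.1 ≠ op e.1}, f e'

/-- The `z`-eigenspace of the edge Laplacian on edges pointing away from `o`. -/
def edgeEigAway (o : X) (z : ℂ) : Set (↥(away G o) → ℂ) :=
  {f | ∀ e, edgeLapAway G o f e = z * f e}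

/-! ## Boundary at infinity -/

/-- A ray: an infinite non-backtracking chain of vertices. -/
def IsRay (r : ℕ → X) : Prop := (∀ n, G.Adj (r n) (r (n + 1))) ∧ ∀ n, r (n + 2) ≠ r n

abbrev Ray := {r : ℕ → X // IsRay G r}

/-- Two rays are equivalent if they share infinitely many vertices. -/
def RayRel (r r' : Ray G) : Prop := (Set.range r.1 ∩ Set.range r'.1).Infinite

/-- The boundary at infinity: equivalence classes of rays. -/
def Boundary := Quot (RayRel G)

/-- The set `∂₊ e` of boundary points reachable by a non-backtracking chain starting with `e`. -/
def plusBd (e : DE G) : Set (Boundary G) :=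
  {ω | ∃ r : Ray G, Quot.mk (RayRel G) r = ω ∧ r.1 0 = ini e ∧ r.1 1 = ter e}

/-- The topology on the boundary generated by the sets `∂₊ e`. -/
instance : TopologicalSpace (Boundary G) :=
  TopologicalSpace.generateFrom {s | ∃ e : DE G, s = plusBd G e}

/-- The space of locally constant functions on the boundary. -/
noncomputable def Clc : Submodule ℂ (Boundary G → ℂ) where
  carrier := {f | IsLocallyConstant f}
  add_mem' hf hg := hf.comp₂ hg (· + ·)
  zero_mem' := IsLocallyConstant.const 0
  smul_mem' c f hf := hf.comp (c * ·)

/-- `D'(Ω)`: the algebraic dual of the space of locally constant functions on the boundary. -/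
abbrev DualB := Module.Dual ℂ ↥(Clc G)

/-- Pairing of a functional on `C^lc(Ω)` with a function on the boundary. -/
noncomputable def pairB (μ : DualB G) (g : Boundary G → ℂ) : ℂ :=
  if h : IsLocallyConstant g then μ ⟨g, h⟩ else 0

/-- The horocycle bracket `⟨x, ω⟩` with respect to the base point `o`: the unique integer `k`
such that `d(x, r n) = n - k` for every ray `r` from `o` representing `ω` and all large `n`. -/
noncomputable def horo (o x : X) (ω : Boundary G) : ℤ :=
  if h : ∃ k : ℤ, ∀ r : Ray G, Quot.mk (RayRel G) r = ω → r.1 0 = o →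
      ∃ N : ℕ, ∀ n : ℕ, N ≤ n → (G.dist x (r.1 n) : ℤ) = (n : ℤ) - k
  then h.choose else 0

/-- The scalar Poisson transform. -/
noncomputable def poisson (o : X) (z : ℂ) (μ : DualB G) (x : X) : ℂ :=
  pairB G μ fun ω => z ^ horo G o x ω

/-- The edge Poisson transform. -/
noncomputable def edgePoisson (o : X) (z : ℂ) (μ : DualB G) (e : DE G) : ℂ :=
  pairB G μ fun ω => z ^ horo G o (ini e) ω * Set.indicator (plusBd G e) 1 ω

/-! ## The shift space of non-backtracking chains of edges -/

/-- An infinite concatenated non-backtracking sequence of directed edges. -/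
def IsChainSeq (c : ℕ → DE G) : Prop :=
  ∀ i, ter (c i) = ini (c (i + 1)) ∧ ter (c (i + 1)) ≠ ini (c i)

/-- The shift space `𝔓`. -/
abbrev ChainSp := {c : ℕ → DE G // IsChainSeq G c}

/-- The one-sided shift on chains. -/
def shift (c : ChainSp G) : ChainSp G := ⟨fun n => c.1 (n + 1), fun i => c.2 (i + 1)⟩

/-- The district (cylinder) topology on the shift space. -/
instance : TopologicalSpace (ChainSp G) :=
  TopologicalSpace.generateFrom
    {s | ∃ (c₀ : ChainSp G) (n : ℕ), s = {c : ChainSp G | ∀ i ≤ n, c.1 i = c₀.1 i}}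

/-- The Ruelle transfer operator. -/
noncomputable def transfer (F : ChainSp G → ℂ) (c : ChainSp G) : ℂ :=
  ∑ᶠ c' ∈ {c' : ChainSp G | shift G c' = c}, F c'

/-- Functions on chains depending only on the first `N` edges. -/
def cylFun (N : ℕ) : Set (ChainSp G → ℂ) :=
  {F | ∀ c c' : ChainSp G, (∀ i < N, c.1 i = c'.1 i) → F c = F c'}

/-- The ray of initial vertices of a chain of edges. -/
def toRay (c : ChainSp G) : Ray G :=
  ⟨fun n => ini (c.1 n), by
    refine ⟨fun n => ?_, fun n => ?_⟩
    · have h1 : ter (c.1 n) = ini (c.1 (n + 1)) := (c.2 n).1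
      have h2 : G.Adj (ini (c.1 n)) (ter (c.1 n)) := (c.1 n).2
      rwa [h1] at h2
    · have h1 : ter (c.1 (n + 1)) = ini (c.1 (n + 2)) := (c.2 (n + 1)).1
      have h2 : ter (c.1 (n + 1)) ≠ ini (c.1 n) := (c.2 n).2
      rwa [h1] at h2⟩

/-- The endpoint map `B : 𝔓 → Ω`. -/
def endB (c : ChainSp G) : Boundary G := Quot.mk (RayRel G) (toRay G c)

/-- The pushforward `B_⋆` by fiber summation. -/
noncomputable def push (f : ChainSp G → ℂ) (ω : Boundary G) : ℂ :=
  ∑ᶠ c ∈ {c : ChainSp G | endB G c = ω}, f c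

/-- The space of locally constant compactly supported functions on the shift space. -/
noncomputable def CcP : Submodule ℂ (ChainSp G → ℂ) where
  carrier := {F | IsLocallyConstant F ∧ HasCompactSupport F}
  add_mem' hf hg := ⟨hf.1.comp₂ hg.1 (· + ·), hf.2.add hg.2⟩
  zero_mem' := ⟨IsLocallyConstant.const 0, HasCompactSupport.zero⟩
  smul_mem' c f hf := ⟨hf.1.comp (c * ·),
    hf.2.mono fun x hx h0 => hx (by simp [h0])⟩

/-- `D'(𝔓)`: the algebraic dual of `C^lc_c(𝔓)`. -/
abbrev DualP := Module.Dual ℂ ↥(CcP G)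

/-- Pairing of a functional on `C^lc_c(𝔓)` with a function on the shift space. -/
noncomputable def pairP (lam : DualP G) (g : ChainSp G → ℂ) : ℂ :=
  if h : g ∈ CcP G then lam ⟨g, h⟩ else 0

/-- The space of locally constant functions on the shift space (for finite graphs this is
`C^lc_c(𝔓)` since `𝔓` is compact). -/
noncomputable def ClcP : Submodule ℂ (ChainSp G → ℂ) where
  carrier := {F | IsLocallyConstant F}
  add_mem' hf hg := hf.comp₂ hg (· + ·)
  zero_mem' := IsLocallyConstant.const 0
  smul_mem' c f hf := hf.comp (c * ·)

/-- The dual of `C^lc(𝔓)`. -/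
abbrev DualPc := Module.Dual ℂ ↥(ClcP G)

/-- Pairing of a functional on `C^lc(𝔓)` with a function on the shift space. -/
noncomputable def pairPc (lam : DualPc G) (g : ChainSp G → ℂ) : ℂ :=
  if h : IsLocallyConstant g then lam ⟨g, h⟩ else 0

/-! ## Vertex Laplacian -/

/-- The vertex Laplacian (averaging over neighbors). -/
noncomputable def vertexLap (f : X → ℂ) (x : X) : ℂ :=
  ((deg G x : ℂ))⁻¹ * ∑ᶠ e ∈ {e : DE G | ini e = x}, f (ter e)

/-- The function `χ(z)(x) = (z + q_x z⁻¹)/(q_x + 1)`. -/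
noncomputable def chi (z : ℂ) (x : X) : ℂ :=
  (z + ((deg G x : ℂ) - 1) * z⁻¹) / (deg G x : ℂ)

/-- The `χ(z)`-eigenspace of the vertex Laplacian. -/
def vertexEig (z : ℂ) : Set (X → ℂ) := {f | ∀ x, vertexLap G f x = chi G z x * f x}

/-! ## Miscellaneous -/

/-- Two subsets of complex vector spaces (in practice: subspaces) are linearly isomorphic. -/
def AreLinIso {M N : Type} [AddCommMonoid M] [Module ℂ M] [AddCommMonoid N] [Module ℂ N]
    (A : Set M) (B : Set N) : Prop :=
  ∃ F : M → N, Set.BijOn F A B ∧ (∀ a ∈ A, ∀ b ∈ A, F (a + b) = F a + F b) ∧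
    ∀ (c : ℂ), ∀ a ∈ A, F (c • a) = c • F a

/-- The `z`-eigenspace of the edge Laplacian as a submodule (for a locally finite graph). -/
noncomputable def edgeEigSub (hlf : LocFin G) (z : ℂ) : Submodule ℂ (DE G → ℂ) where
  carrier := edgeEig G z
  add_mem' := by
    intro f g hf hg e
    have hS : {e' : DE G | ini e' = ter e ∧ e' ≠ op e}.Finite :=
      (hlf (ter e)).subset fun _ h => h.1
    have : edgeLap G (f + g) e = edgeLap G f e + edgeLap G g e := by
      simpa [edgeLap] using finsum_mem_add_distrib (f := f) (g := g) hS
    rw [this, hf e, hg e, Pi.add_apply, mul_add]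
  zero_mem' := by
    intro e
    simp [edgeLap]
  smul_mem' := by
    intro c f hf e
    have hS : {e' : DE G | ini e' = ter e ∧ e' ≠ op e}.Finite :=
      (hlf (ter e)).subset fun _ h => h.1
    have : edgeLap G (c • f) e = c * edgeLap G f e := by
      simp only [edgeLap, Pi.smul_apply, smul_eq_mul]
      rw [finsum_mem_eq_finite_toFinset_sum _ hS, finsum_mem_eq_finite_toFinset_sum _ hS,
        Finset.mul_sum]
    rw [Pi.smul_apply, smul_eq_mul, this, hf e]; ring

/-- The cyclomatic number of a finite graph, as an integer. -/
noncomputable def cyclo : ℤ := (Nat.card G.edgeSet : ℤ) - (Nat.card X : ℤ) + 1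

/-- 2-colorability. -/
def TwoColorable : Prop := ∃ col : X → Bool, ∀ x y : X, G.Adj x y → col x ≠ col y

section Dimension

/-- Functions on the vertices that change sign along every edge. -/
def alternating : Submodule ℂ (X → ℂ) where
  carrier := {s | ∀ x y, G.Adj x y → s y = -s x}
  add_mem' {s t} hs ht x y h := by simp [hs x y h, ht x y h, add_comm]
  zero_mem' x y _ := by simp
  smul_mem' c s hs x y h := by simp [hs x y h]

/-- The undirected edge underlying a directed edge. -/
def und (e : DE G) : G.edgeSet := ⟨s(ini e, ter e), e.2⟩

/-- The function on directed edges with given symmetric part and with antisymmetric part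
determined by an alternating function on the vertices. -/
noncomputable def assemble :
    ((G.edgeSet → ℂ) × alternating G) →ₗ[ℂ] (DE G → ℂ) where
  toFun v e := v.1 (und G e) + (v.2 : X → ℂ) (ini e) / 2
  map_add' v w := by ext e; simp; ring
  map_smul' c v := by ext e; simp; ring

variable {G}

lemma op_op (e : DE G) : op (op e) = e := rfl

lemma und_op (e : DE G) : und G (op e) = und G e := Subtype.ext Sym2.eq_swap

lemma und_surjective (ε : G.edgeSet) : ∃ e : DE G, und G e = ε := by
  obtain ⟨ε, hε⟩ := ε
  induction ε with
  | _ x y => exact ⟨⟨(x, y), hε⟩, rfl⟩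

lemma eq_or_eq_op_of_und_eq {e e' : DE G} (h : und G e = und G e') : e = e' ∨ e = op e' := by
  have h1 : s(ini e, ter e) = s(ini e', ter e') := congrArg Subtype.val h
  rcases Sym2.eq_iff.1 h1 with h2 | h2
  · exact Or.inl (Subtype.ext (Prod.ext h2.1 h2.2))
  · exact Or.inr (Subtype.ext (Prod.ext h2.1 h2.2))

lemma assemble_op_sub (v : (G.edgeSet → ℂ) × alternating G) (e : DE G) :
    assemble G v (op e) - assemble G v e = (v.2 : X → ℂ) (ter e) := by
  have h : (v.2 : X → ℂ) (ter e) = -(v.2 : X → ℂ) (ini e) := v.2.2 _ _ e.2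
  have h1 : ini (op e) = ter e := rfl
  simp only [assemble, LinearMap.coe_mk, AddHom.coe_mk, und_op, h1]
  linear_combination -h / 2

lemma exists_ter_eq (hnd : ∀ x : X, 2 ≤ deg G x) (x : X) : ∃ e : DE G, ter e = x := by
  have h : {e : DE G | ini e = x}.ncard ≠ 0 := by have := hnd x; unfold deg at this; omega
  obtain ⟨e, he⟩ := Set.nonempty_of_ncard_ne_zero h
  exact ⟨op e, he⟩

lemma assemble_injective (hnd : ∀ x : X, 2 ≤ deg G x) : Injective (assemble G) := by
  rw [← LinearMap.ker_eq_bot, LinearMap.ker_eq_bot']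
  rintro ⟨g, s⟩ hv
  have hs : s = 0 := by
    ext x
    obtain ⟨e, rfl⟩ := exists_ter_eq hnd x
    simpa [hv] using (assemble_op_sub (g, s) e).symm
  subst hs
  refine Prod.ext (funext fun ε => ?_) rfl
  obtain ⟨e, rfl⟩ := und_surjective ε
  simpa [assemble] using congrFun hv e

lemma eq_of_connected {α : Type*} (hconn : G.Connected) {u : X → α}
    (hu : ∀ x y, G.Adj x y → u x = u y) (x y : X) : u x = u y := by
  obtain ⟨w⟩ := hconn.preconnected x y
  induction w with
  | nil => rfl
  | cons h _ ih => exact (hu _ _ h).trans ih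

lemma alternating_eq_bot (hconn : G.Connected) (h : ¬ TwoColorable G) : alternating G = ⊥ := by
  rw [Submodule.eq_bot_iff]
  intro s hs
  by_contra hne
  obtain ⟨x₀, hx₀⟩ := Function.ne_iff.1 hne
  have hpm : ∀ x, s x = s x₀ ∨ s x = -s x₀ := fun x => sq_eq_sq_iff_eq_or_eq_neg.1
    (eq_of_connected (u := fun x => s x ^ 2) hconn
      (fun x y hxy => by simp only [hs x y hxy]; ring) x x₀)
  refine h ⟨fun x => decide (s x = s x₀), fun x y hxy => ?_⟩
  have hself : -s x₀ ≠ s x₀ := fun h => hx₀ (self_eq_neg.1 h.symm)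
  rcases hpm x with hx | hx <;> simp [hs x y hxy, hx, hself]

lemma exists_alternating_ne_zero (h : TwoColorable G) :
    ∃ s ∈ alternating G, ∀ x, s x ≠ 0 := by
  obtain ⟨col, hcol⟩ := h
  refine ⟨fun x => if col x then 1 else -1, fun x y hxy => ?_, fun x => ?_⟩
  · have := hcol x y hxy
    cases hx : col x <;> cases hy : col y <;> simp_all
  · dsimp only
    split_ifs <;> simp

lemma finrank_alternating (hconn : G.Connected) (h : TwoColorable G) :
    Module.finrank ℂ (alternating G) = 1 := by
  obtain ⟨σ, hσ, hσ0⟩ := exists_alternating_ne_zero h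
  obtain ⟨x₀⟩ := hconn.nonempty
  refine (finrank_eq_one_iff_of_nonzero' (⟨σ, hσ⟩ : alternating G) fun h0 => hσ0 x₀
    (congrFun (congrArg Subtype.val h0) x₀)).2 fun s => ⟨(s : X → ℂ) x₀ / σ x₀, ?_⟩
  ext x
  have hc := eq_of_connected (u := fun x => (s : X → ℂ) x / σ x) hconn
    (fun x y hxy => by simp only [s.2 x y hxy, hσ x y hxy, neg_div_neg_eq]) x₀ x
  change (s : X → ℂ) x₀ / σ x₀ * σ x = (s : X → ℂ) x
  rw [hc, div_mul_cancel₀ _ (hσ0 x)]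

variable (G) [Fintype X]

/-- The sum of a function over the directed edges starting at a vertex. -/
noncomputable def outSum : (DE G → ℂ) →ₗ[ℂ] (X → ℂ) where
  toFun f x := ∑ e : DE G with ini e = x, f e
  map_add' f g := by ext x; simp [Finset.sum_add_distrib]
  map_smul' c f := by ext x; simp [Finset.mul_sum]

/-- The defect between the vertex sums of an assembled function and the given alternating
function. -/
noncomputable def defect : ((G.edgeSet → ℂ) × alternating G) →ₗ[ℂ] (X → ℂ) :=
  outSum G ∘ₗ assemble G - (alternating G).subtype ∘ₗ LinearMap.snd ℂ _ _

variable {G}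

lemma sum_op (f : DE G → ℂ) : ∑ e, f (op e) = ∑ e, f e :=
  Equiv.sum_comp (Function.Involutive.toPerm (op : DE G → DE G) op_op) f

lemma edgeLap_eq (f : DE G → ℂ) (e : DE G) :
    edgeLap G f e = outSum G f (ter e) - f (op e) := by
  have h : op e ∈ Finset.univ.filter fun e' : DE G => ini e' = ter e :=
    Finset.mem_filter.2 ⟨Finset.mem_univ _, rfl⟩
  have h2 : {e' : DE G | ini e' = ter e ∧ e' ≠ op e} =
      ↑((Finset.univ.filter fun e' : DE G => ini e' = ter e).erase (op e)) := by
    ext e'; simp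
  rw [edgeLap, h2, finsum_mem_coe_finset, eq_sub_iff_add_eq, Finset.sum_erase_add _ _ h]
  rfl

lemma mem_edgeEigSub_neg_one {hlf : LocFin G} {f : DE G → ℂ} :
    f ∈ edgeEigSub G hlf (-1) ↔ ∀ e, outSum G f (ter e) = f (op e) - f e := by
  change (∀ e, edgeLap G f e = -1 * f e) ↔ _
  refine forall_congr' fun e => ?_
  rw [edgeLap_eq]
  constructor <;> intro h <;> linear_combination h

lemma assemble_mem_edgeEigSub_iff (hnd : ∀ x : X, 2 ≤ deg G x) {hlf : LocFin G}
    (v : (G.edgeSet → ℂ) × alternating G) :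
    assemble G v ∈ edgeEigSub G hlf (-1) ↔ defect G v = 0 := by
  rw [mem_edgeEigSub_neg_one]
  simp only [assemble_op_sub]
  constructor
  · intro h
    ext x
    obtain ⟨e, rfl⟩ := exists_ter_eq hnd x
    simp [defect, h e]
  · intro h e
    exact sub_eq_zero.1 (congrFun h (ter e))

lemma exists_assemble_eq {hlf : LocFin G} {f : DE G → ℂ}
    (hf : f ∈ edgeEigSub G hlf (-1)) : ∃ v, assemble G v = f := by
  rw [mem_edgeEigSub_neg_one] at hf
  have hs : outSum G f ∈ alternating G := by
    intro x y h
    have h1 := hf ⟨(x, y), h⟩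
    have h2 := hf ⟨(y, x), h.symm⟩
    simp only [ter, op] at h1 h2
    rw [h1, h2]; ring
  choose r hr using und_surjective (G := G)
  refine ⟨(fun ε => f (r ε) - outSum G f (ini (r ε)) / 2, ⟨_, hs⟩), funext fun e => ?_⟩
  simp only [assemble, LinearMap.coe_mk, AddHom.coe_mk]
  rcases eq_or_eq_op_of_und_eq (hr (und G e)) with h | h
  · rw [h]; ring
  · rw [h]
    have h1 := hf e
    have h2 : outSum G f (ter e) = -outSum G f (ini e) := hs _ _ e.2
    have h3 : ini (op e) = ter e := rfl
    rw [h3]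
    linear_combination h2 / 2 - h1

lemma finrank_edgeEigSub_neg_one (hnd : ∀ x : X, 2 ≤ deg G x) (hlf : LocFin G) :
    Module.finrank ℂ (edgeEigSub G hlf (-1)) = Module.finrank ℂ (LinearMap.ker (defect G)) := by
  have h : edgeEigSub G hlf (-1) = (LinearMap.ker (defect G)).map (assemble G) := by
    ext f
    constructor
    · intro hf
      obtain ⟨v, rfl⟩ := exists_assemble_eq hf
      exact ⟨v, (assemble_mem_edgeEigSub_iff hnd v).1 hf, rfl⟩
    · rintro ⟨v, hv, rfl⟩
      exact (assemble_mem_edgeEigSub_iff hnd v).2 hv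
  rw [h]
  exact (Submodule.equivMapOfInjective _ (assemble_injective hnd) _).finrank_eq.symm

/-- The vectors orthogonal to the range of a linear map. -/
noncomputable def orthRange {V : Type*} [AddCommGroup V] [Module ℂ V] (T : V →ₗ[ℂ] (X → ℂ)) :
    Submodule ℂ (X → ℂ) :=
  (LinearMap.ker T.dualMap).comap (dotProductEquiv ℂ X).toLinearMap

lemma mem_orthRange {V : Type*} [AddCommGroup V] [Module ℂ V] {T : V →ₗ[ℂ] (X → ℂ)}
    {h : X → ℂ} : h ∈ orthRange T ↔ ∀ v, ∑ x, h x * T v x = 0 := by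
  simp only [orthRange, Submodule.mem_comap, LinearMap.mem_ker]
  exact LinearMap.ext_iff

lemma finrank_ker_add_card {V : Type*} [AddCommGroup V] [Module ℂ V] [FiniteDimensional ℂ V]
    (T : V →ₗ[ℂ] (X → ℂ)) :
    Module.finrank ℂ (LinearMap.ker T) + Fintype.card X =
      Module.finrank ℂ V + Module.finrank ℂ (orthRange T) := by
  have h1 := T.finrank_range_add_finrank_ker
  have h2 := T.dualMap.finrank_range_add_finrank_ker
  rw [LinearMap.finrank_range_dualMap_eq_finrank_range, Subspace.dual_finrank_eq,
    Module.finrank_fintype_fun_eq_card] at h2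
  have h3 : Module.finrank ℂ (orthRange T) = Module.finrank ℂ (LinearMap.ker T.dualMap) :=
    ((dotProductEquiv ℂ X).ofSubmodule' _).finrank_eq
  omega

lemma sum_mul_outSum (h : X → ℂ) (f : DE G → ℂ) :
    ∑ x, h x * outSum G f x = ∑ e, h (ini e) * f e := by
  rw [← Finset.sum_fiberwise (s := Finset.univ) (g := fun e : DE G => ini e)]
  refine Finset.sum_congr rfl fun x _ => ?_
  simp only [outSum, LinearMap.coe_mk, AddHom.coe_mk, Finset.mul_sum]
  refine Finset.sum_congr rfl fun e he => ?_
  rw [(Finset.mem_filter.1 he).2]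

lemma card_directedEdge : Fintype.card (DE G) = 2 * Nat.card G.edgeSet := by
  have e : DE G ≃ G.Dart :=
    ⟨fun e => ⟨e.1, e.2⟩, fun d => ⟨d.toProd, d.adj⟩, fun _ => rfl, fun _ => rfl⟩
  rw [Fintype.card_congr e, SimpleGraph.dart_card_eq_twice_card_edges,
    Nat.card_eq_fintype_card, SimpleGraph.edgeFinset_card]

lemma sum_mul_assemble {h : X → ℂ} (hh : h ∈ alternating G)
    (v : (G.edgeSet → ℂ) × alternating G) :
    ∑ e, h (ini e) * assemble G v e = ∑ e : DE G, h (ini e) * (v.2 : X → ℂ) (ini e) / 2 := by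
  have h0 : ∑ e : DE G, h (ini e) * v.1 (und G e) = 0 := by
    have h1 := sum_op fun e : DE G => h (ini e) * v.1 (und G e)
    have h2 : ∀ e : DE G, h (ini (op e)) * v.1 (und G (op e)) = -(h (ini e) * v.1 (und G e)) := by
      intro e
      rw [und_op, show h (ini (op e)) = -h (ini e) from hh _ _ e.2]; ring
    simp only [h2, Finset.sum_neg_distrib] at h1
    exact self_eq_neg.1 h1.symm
  simp only [assemble, LinearMap.coe_mk, AddHom.coe_mk, mul_add, Finset.sum_add_distrib, h0,
    zero_add, mul_div_assoc]

lemma sum_mul_defect (hconn : G.Connected) {h : X → ℂ} (hh : h ∈ alternating G)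
    (v : (G.edgeSet → ℂ) × alternating G) (x₀ : X) :
    ∑ x, h x * defect G v x =
      ((Nat.card G.edgeSet : ℂ) - Fintype.card X) * (h x₀ * (v.2 : X → ℂ) x₀) := by
  have hc : ∀ x, h x * (v.2 : X → ℂ) x = h x₀ * (v.2 : X → ℂ) x₀ := fun x =>
    eq_of_connected (u := fun x => h x * (v.2 : X → ℂ) x) hconn
      (fun x y hxy => by simp only [hh x y hxy, v.2.2 x y hxy]; ring) x x₀
  simp only [defect, LinearMap.sub_apply, LinearMap.comp_apply, Pi.sub_apply, mul_sub,
    Finset.sum_sub_distrib, sum_mul_outSum, sum_mul_assemble hh, Submodule.subtype_apply,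
    LinearMap.snd_apply, hc, Finset.sum_const, Finset.card_univ, card_directedEdge, nsmul_eq_mul]
  push_cast
  ring

lemma orthRange_defect_le : orthRange (defect G) ≤ alternating G := by
  intro h hh x y hxy
  have h1 := mem_orthRange.1 hh (Pi.single (und G ⟨(x, y), hxy⟩) 1, 0)
  have h2 : ∀ e : DE G, assemble G (Pi.single (und G ⟨(x, y), hxy⟩) 1, 0) e =
      (if e = ⟨(x, y), hxy⟩ then 1 else 0) + (if e = ⟨(y, x), hxy.symm⟩ then 1 else 0) := by
    intro e
    have hne : (⟨(x, y), hxy⟩ : DE G) ≠ ⟨(y, x), hxy.symm⟩ := by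
      simp [hxy.ne]
    by_cases ha : e = ⟨(x, y), hxy⟩
    · subst ha
      simp [assemble, hne]
    · by_cases hb : e = ⟨(y, x), hxy.symm⟩
      · subst hb
        have : und G ⟨(y, x), hxy.symm⟩ = und G ⟨(x, y), hxy⟩ := und_op ⟨(x, y), hxy⟩
        simp [assemble, this, hne.symm]
      · have : und G e ≠ und G ⟨(x, y), hxy⟩ := fun h =>
          (eq_or_eq_op_of_und_eq h).elim ha hb
        simp [assemble, ha, hb, this]
  simp only [defect, LinearMap.sub_apply, LinearMap.comp_apply, Pi.sub_apply, mul_sub,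
    Finset.sum_sub_distrib, sum_mul_outSum, h2, mul_add, Finset.sum_add_distrib] at h1
  simp [ini] at h1
  linear_combination h1

lemma orthRange_defect_eq_alternating (hconn : G.Connected)
    (hcard : Nat.card G.edgeSet = Fintype.card X) : orthRange (defect G) = alternating G := by
  refine le_antisymm orthRange_defect_le fun h hh => mem_orthRange.2 fun v => ?_
  obtain ⟨x₀⟩ := hconn.nonempty
  rw [sum_mul_defect hconn hh v x₀, hcard]
  simp

lemma orthRange_defect_eq_bot (hconn : G.Connected) (h2 : TwoColorable G)
    (hcard : Nat.card G.edgeSet ≠ Fintype.card X) : orthRange (defect G) = ⊥ := by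
  obtain ⟨σ, hσ, hσ0⟩ := exists_alternating_ne_zero h2
  rw [Submodule.eq_bot_iff]
  intro h hh
  ext x
  have h1 := mem_orthRange.1 hh (0, ⟨σ, hσ⟩)
  rw [sum_mul_defect hconn (orthRange_defect_le hh) _ x] at h1
  have h3 : (Nat.card G.edgeSet : ℂ) - Fintype.card X ≠ 0 :=
    sub_ne_zero.2 (by exact_mod_cast hcard)
  exact (mul_eq_zero.1 ((mul_eq_zero.1 h1).resolve_left h3)).resolve_right (hσ0 x)

lemma finrank_edgeEigSub_add_card (hnd : ∀ x : X, 2 ≤ deg G x) (hlf : LocFin G) :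
    Module.finrank ℂ (edgeEigSub G hlf (-1)) + Nat.card X = Nat.card G.edgeSet +
      Module.finrank ℂ (alternating G) + Module.finrank ℂ (orthRange (defect G)) := by
  rw [finrank_edgeEigSub_neg_one hnd, Nat.card_eq_fintype_card, finrank_ker_add_card,
    Module.finrank_prod, Module.finrank_fintype_fun_eq_card, Nat.card_eq_fintype_card]

end Dimension

/-- Dimension of the `(-1)`-eigenspace of the edge Laplacian of a finite
graph in terms of the cyclomatic number and 2-colorability. -/
theorem statement15 {X : Type} [Finite X] (G : SimpleGraph X) (hconn : G.Connected)
    (hnd : ∀ x : X, 2 ≤ deg G x) (hlf : LocFin G) :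
    (TwoColorable G → cyclo G = 1 → Module.finrank ℂ ↥(edgeEigSub G hlf (-1)) = 2) ∧
    (TwoColorable G → cyclo G ≠ 1 →
      (Module.finrank ℂ ↥(edgeEigSub G hlf (-1)) : ℤ) = cyclo G) ∧
    (¬ TwoColorable G →
      (Module.finrank ℂ ↥(edgeEigSub G hlf (-1)) : ℤ) = cyclo G - 1) := by
  have := Fintype.ofFinite X
  have hdim := finrank_edgeEigSub_add_card hnd hlf
  refine ⟨fun h2 hc => ?_, fun h2 hc => ?_, fun h2 => ?_⟩
  · have hcard : Nat.card G.edgeSet = Nat.card X := by unfold cyclo at hc; omega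
    rw [orthRange_defect_eq_alternating hconn (by rw [hcard, Nat.card_eq_fintype_card]),
      finrank_alternating hconn h2] at hdim
    omega
  · have hcard : Nat.card G.edgeSet ≠ Nat.card X := by unfold cyclo at hc; omega
    rw [orthRange_defect_eq_bot hconn h2 (by rwa [← Nat.card_eq_fintype_card]),
      finrank_alternating hconn h2, finrank_bot] at hdim
    unfold cyclo
    omega
  · have hbot := alternating_eq_bot hconn h2
    rw [eq_bot_iff.2 (orthRange_defect_le.trans_eq hbot), hbot, finrank_bot] at hdim
    unfold cyclo
    omega

end GraphQCC
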